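/- Let f: ℝ^{2d}\{0} → ℝ be smooth such that {f ≤ 1} is a compact convex body containing 0 in its interior, ∇f ≠ 0 on M := {f = 1}, and the normal Gauss map G: M → S^{2d−1}, G(q) = ∇f(q)/|∇f(q)|, is a homeomorphism. Then for every x with f(x) > 1 there exist q ∈ M and t > 0 such that x = q + t·J∇f(q). In other words, the positive characteristic rays of M cover the whole exterior of M. -/

import Mathlib

/-- Hartman–Stampacchia for strongly monotone affine operators: the operator `q ↦ ε q - J (q - x)`
with `J` skew isometric admits a solution of its variational inequality on a complete convex set. -/
theorem exists_regularized_variational_inequality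
    {E : Type*} [NormedAddCommGroup E] [InnerProductSpace ℝ E] [CompleteSpace E]
    (J : E →ₗᵢ[ℝ] E) (hskew : ∀ v, inner ℝ (J v) v = 0) {K : Set E} (hne : K.Nonempty)
    (hK : IsComplete K) (hconv : Convex ℝ K) (x : E) {ε : ℝ} (hε : 0 < ε) :
    ∃ q ∈ K, ∀ y ∈ K, inner ℝ (J (q - x) - ε • q) (y - q) ≤ 0 := by
  have hproj : ∀ u : E, ∃ v ∈ K, ∀ y ∈ K, inner ℝ (u - v) (y - v) ≤ 0 := fun u => by
    obtain ⟨v, hv, h⟩ := exists_norm_eq_iInf_of_complete_convex hne hK hconv u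
    exact ⟨v, hv, (norm_eq_iInf_iff_real_inner_le_zero hconv hv).1 h⟩
  choose P hPmem hP using hproj
  have hPlip : ∀ u v, ‖P u - P v‖ ≤ ‖u - v‖ := fun u v => by
    have h₁ := hP u (P v) (hPmem v)
    have h₂ := hP v (P u) (hPmem u)
    have h₃ : ‖P u - P v‖ ^ 2 ≤ inner ℝ (u - v) (P u - P v) := by
      rw [← real_inner_self_eq_norm_sq]
      simp only [inner_sub_left, inner_sub_right] at h₁ h₂ ⊢
      linarith
    have h₄ := real_inner_le_norm (u - v) (P u - P v)
    by_contra! h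
    nlinarith [norm_nonneg (u - v), norm_nonneg (P u - P v)]
  set l : ℝ := ε / (1 + ε ^ 2) with hl
  have hl_pos : 0 < l := by positivity
  have hl_mul : l * (1 + ε ^ 2) = ε := by rw [hl]; field_simp
  let T : E → E := fun q => q + l • (J (q - x) - ε • q)
  have hT : ∀ u v, ‖T u - T v‖ ^ 2 = (1 - l * ε) * ‖u - v‖ ^ 2 := fun u v => by
    have h : T u - T v = (1 - l * ε) • (u - v) + l • J (u - v) := by
      have : J (u - v) = J (u - x) - J (v - x) := by rw [← map_sub]; congr 1; abel
      simp only [T, this]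
      module
    rw [h, norm_add_sq_real, norm_smul, norm_smul, J.norm_map, inner_smul_left, inner_smul_right,
      real_inner_comm, hskew, mul_pow, mul_pow, Real.norm_eq_abs, Real.norm_eq_abs, sq_abs, sq_abs]
    linear_combination (l * ‖u - v‖ ^ 2) * hl_mul
  have hc_nonneg : 0 ≤ 1 - l * ε := by
    have : l * ε * (1 + ε ^ 2) = ε ^ 2 := by linear_combination ε * hl_mul
    by_contra! h
    nlinarith [sq_nonneg ε]
  have hcontr : ContractingWith (Real.sqrt (1 - l * ε)).toNNReal (fun q => P (T q)) := by
    refine ⟨?_, LipschitzWith.of_dist_le_mul fun u v => ?_⟩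
    · rw [Real.toNNReal_lt_one, Real.sqrt_lt' one_pos]
      nlinarith [mul_pos hl_pos hε]
    · rw [Real.coe_toNNReal _ (Real.sqrt_nonneg _), dist_eq_norm, dist_eq_norm]
      refine (hPlip _ _).trans (le_of_eq ?_)
      rw [← Real.sqrt_sq (norm_nonneg (T u - T v)), hT, Real.sqrt_mul hc_nonneg,
        Real.sqrt_sq (norm_nonneg _)]
  have : Nonempty E := ⟨x⟩
  have hfix : P (T (hcontr.fixedPoint)) = hcontr.fixedPoint := hcontr.fixedPoint_isFixedPt
  generalize hcontr.fixedPoint = q at hfix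
  refine ⟨q, hfix ▸ hPmem _, fun y hy => ?_⟩
  have h := hP (T q) y hy
  rw [hfix] at h
  simp only [T, add_sub_cancel_left, inner_smul_left] at h
  exact nonpos_of_mul_nonpos_right h hl_pos

open Filter Topology in
/-- The variational inequality of the skew operator `q ↦ -J (q - x)` is solvable on a nonempty
compact convex set. -/
theorem exists_skew_variational_inequality
    {E : Type*} [NormedAddCommGroup E] [InnerProductSpace ℝ E] [CompleteSpace E]
    (J : E →ₗᵢ[ℝ] E) (hskew : ∀ v, inner ℝ (J v) v = 0) {K : Set E} (hne : K.Nonempty)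
    (hK : IsCompact K) (hconv : Convex ℝ K) (x : E) :
    ∃ q ∈ K, ∀ y ∈ K, inner ℝ (J (q - x)) (y - q) ≤ 0 := by
  choose a ha_mem ha using fun n : ℕ =>
    exists_regularized_variational_inequality J hskew hne hK.isComplete hconv x
      (Nat.one_div_pos_of_nat (α := ℝ) (n := n))
  obtain ⟨q, hq, φ, hφ, hlim⟩ := hK.tendsto_subseq ha_mem
  refine ⟨q, hq, fun y hy => ?_⟩
  have hε : Tendsto (fun n => 1 / ((φ n : ℝ) + 1)) atTop (𝓝 0) :=
    (tendsto_one_div_add_atTop_nhds_zero_nat (𝕜 := ℝ)).comp hφ.tendsto_atTop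
  have h := (((J.continuous.tendsto _).comp (hlim.sub_const x)).sub (hε.smul hlim)).inner
    (𝕜 := ℝ) (hlim.const_sub y)
  rw [zero_smul, sub_zero] at h
  exact le_of_tendsto h (Eventually.of_forall fun n => ha (φ n) y hy)

/-- A linear functional maximised over the sublevel set `{f ≤ f q}` at `q` is a nonnegative multiple
of the gradient of `f` at `q`, provided that gradient does not vanish. -/
theorem exists_eq_smul_gradient_of_isMax_inner
    {E : Type*} [NormedAddCommGroup E] [InnerProductSpace ℝ E] [CompleteSpace E]
    {f : E → ℝ} {q g w : E} (hg : HasGradientAt f g q) (hg0 : g ≠ 0)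
    (hmax : ∀ y, f y ≤ f q → inner ℝ w (y - q) ≤ 0) :
    ∃ c : ℝ, 0 ≤ c ∧ w = c • g := by
  have hdir : ∀ v : E, inner ℝ g v < 0 → inner ℝ w v ≤ 0 := fun v hv => by
    have hder : HasDerivAt (fun s : ℝ => f (q + s • v)) (inner ℝ g v) 0 := by
      have h := hg.hasFDerivAt
      have hline : HasDerivAt (fun s : ℝ => q + s • v) v 0 := by
        simpa using ((hasDerivAt_id (0 : ℝ)).smul_const v).const_add q
      have hq : q = q + (0 : ℝ) • v := by simp
      rw [hq] at h
      simpa [Function.comp_def] using h.comp_hasDerivAt (0 : ℝ) hline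
    have hslope := hder.hasDerivWithinAt (s := Set.Ioi 0)
    rw [hasDerivWithinAt_iff_tendsto_slope' (by simp)] at hslope
    obtain ⟨s, hs, hs_pos⟩ :=
      ((hslope.eventually (gt_mem_nhds hv)).and self_mem_nhdsWithin).exists
    have hs_pos : 0 < s := hs_pos
    have hle : f (q + s • v) ≤ f q := by
      rw [slope_def_field, sub_zero, div_lt_iff₀ hs_pos] at hs
      simp only [zero_smul, add_zero, zero_mul] at hs
      linarith
    have h := hmax _ hle
    rw [add_sub_cancel_left, inner_smul_right] at h
    exact nonpos_of_mul_nonpos_right h hs_pos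
  have hgg : 0 < inner ℝ g g := real_inner_self_pos.2 hg0
  have hwg : 0 ≤ inner ℝ w g := by
    have h := hdir (-g) (by rw [inner_neg_right]; linarith)
    rw [inner_neg_right] at h
    linarith
  set c : ℝ := inner ℝ w g / inner ℝ g g with hc
  have hgc : inner ℝ g (w - c • g) = 0 := by
    rw [inner_sub_right, inner_smul_right, hc, real_inner_comm]
    field_simp
    ring
  have hsq : inner ℝ w (w - c • g) = inner ℝ (w - c • g) (w - c • g) := by
    rw [inner_sub_left (x := w), inner_smul_left, hgc]
    simp
  have hlim : ∀ δ : ℝ, 0 < δ → inner ℝ (w - c • g) (w - c • g) ≤ δ * inner ℝ w g := fun δ hδ => by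
    have h := hdir ((w - c • g) - δ • g) (by
      rw [inner_sub_right, hgc, inner_smul_right]
      nlinarith)
    rw [inner_sub_right, inner_smul_right, hsq] at h
    linarith
  refine ⟨c, div_nonneg hwg hgg.le, sub_eq_zero.1 (real_inner_self_nonpos.1 ?_)⟩
  by_contra! h
  have h : 0 < inner ℝ (w - c • g) (w - c • g) := h
  have h₁ := hlim (inner ℝ (w - c • g) (w - c • g) / (2 * (inner ℝ w g + 1))) (by positivity)
  rw [div_mul_eq_mul_div, le_div_iff₀ (by positivity)] at h₁
  nlinarith

/-- Let `f : ℝ^{2d}\{0} → ℝ` be smooth such that `{f ≤ 1}` is a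
compact convex body containing `0` in its interior, `∇f ≠ 0` on `M := {f = 1}`, and the
normal Gauss map `G : M → S^{2d−1}`, `G q = ∇f q / ‖∇f q‖`, is a homeomorphism (with
inverse `Ginv`).  Then for every `x` with `f x > 1` there exist `q ∈ M` and `t > 0` such
that `x = q + t • J ∇f(q)`: the positive characteristic rays of `M` cover the whole
exterior of `M`. -/
theorem stmt17 {d : ℕ}
    (J : EuclideanSpace ℝ (Fin (2 * d)) →ₗᵢ[ℝ] EuclideanSpace ℝ (Fin (2 * d)))
    (hJ : ∀ v, J (J v) = -v)
    (f : EuclideanSpace ℝ (Fin (2 * d)) → ℝ)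
    (hf_smooth : ContDiffOn ℝ (⊤ : ℕ∞) f {(0 : EuclideanSpace ℝ (Fin (2 * d)))}ᶜ)
    (hbody_compact : IsCompact {x : EuclideanSpace ℝ (Fin (2 * d)) | f x ≤ 1})
    (hbody_convex : Convex ℝ {x : EuclideanSpace ℝ (Fin (2 * d)) | f x ≤ 1})
    (hbody_zero : (0 : EuclideanSpace ℝ (Fin (2 * d)))
      ∈ interior {x : EuclideanSpace ℝ (Fin (2 * d)) | f x ≤ 1})
    (hgrad_ne : ∀ q : EuclideanSpace ℝ (Fin (2 * d)), f q = 1 → gradient f q ≠ 0)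
    (hG_cont : ContinuousOn (fun q => ‖gradient f q‖⁻¹ • gradient f q)
      {q : EuclideanSpace ℝ (Fin (2 * d)) | f q = 1})
    (Ginv : EuclideanSpace ℝ (Fin (2 * d)) → EuclideanSpace ℝ (Fin (2 * d)))
    (hGinv_mem : ∀ u : EuclideanSpace ℝ (Fin (2 * d)), ‖u‖ = 1 → f (Ginv u) = 1)
    (hGinv_right : ∀ u : EuclideanSpace ℝ (Fin (2 * d)), ‖u‖ = 1 →
      ‖gradient f (Ginv u)‖⁻¹ • gradient f (Ginv u) = u)
    (hGinv_left : ∀ q : EuclideanSpace ℝ (Fin (2 * d)), f q = 1 →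
      Ginv (‖gradient f q‖⁻¹ • gradient f q) = q)
    (hGinv_cont : ContinuousOn Ginv
      (Metric.sphere (0 : EuclideanSpace ℝ (Fin (2 * d))) 1)) :
    ∀ x : EuclideanSpace ℝ (Fin (2 * d)), 1 < f x →
      ∃ q : EuclideanSpace ℝ (Fin (2 * d)), ∃ t : ℝ,
        f q = 1 ∧ 0 < t ∧ x = q + t • J (gradient f q) := by
  intro x hx
  have hskew : ∀ v, inner ℝ (J v) v = 0 := fun v => by
    have h := J.inner_map_map (J v) v
    rw [hJ, inner_neg_left, real_inner_comm] at h
    linarith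
  obtain ⟨q, hq, hmax⟩ := exists_skew_variational_inequality J hskew
    ⟨0, interior_subset hbody_zero⟩ hbody_compact hbody_convex x
  have hw : J (q - x) ≠ 0 := fun h => by
    rw [map_eq_zero_iff J J.injective, sub_eq_zero] at h
    exact absurd (h ▸ hq : f x ≤ 1) hx.not_ge
  have hq_int : q ∉ interior {x | f x ≤ 1} := fun h => by
    have hlim : Filter.Tendsto (fun s : ℝ => q + s • J (q - x)) (nhdsWithin 0 (Set.Ioi 0))
        (nhds q) := by
      have : Continuous fun s : ℝ => q + s • J (q - x) := by fun_prop
      simpa using (this.tendsto 0).mono_left nhdsWithin_le_nhds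
    obtain ⟨s, hs, hs_pos⟩ :=
      ((hlim.eventually (mem_interior_iff_mem_nhds.1 h)).and self_mem_nhdsWithin).exists
    have hs_pos : 0 < s := hs_pos
    have h' := hmax _ hs
    rw [add_sub_cancel_left, inner_smul_right] at h'
    exact (mul_pos hs_pos (real_inner_self_pos.2 hw)).not_ge h'
  have hq0 : q ≠ 0 := fun h => hq_int (h ▸ hbody_zero)
  have hfq : f q = 1 := by
    refine le_antisymm hq (not_lt.1 fun hlt => hq_int (mem_interior_iff_mem_nhds.2 ?_))
    have hcont : ContinuousAt f q := hf_smooth.continuousOn.continuousAt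
      (isOpen_compl_singleton.mem_nhds hq0)
    filter_upwards [hcont.eventually (gt_mem_nhds hlt)] with y hy using le_of_lt hy
  have hdiff : DifferentiableAt ℝ f q :=
    (hf_smooth.contDiffAt (isOpen_compl_singleton.mem_nhds hq0)).differentiableAt (by simp)
  obtain ⟨c, hc, hcw⟩ := exists_eq_smul_gradient_of_isMax_inner hdiff.hasGradientAt
    (hgrad_ne q hfq) (fun y hy => hmax y (hfq ▸ hy : f y ≤ 1))
  refine ⟨q, c, hfq, lt_of_le_of_ne hc fun h => hw (by rw [hcw, ← h, zero_smul]), ?_⟩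
  rw [← map_smul, ← hcw, hJ]
  abel
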